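/- Let β be a positive even integer and fix x ∈ ℝ. Define w(u₁,…,u_β) := ∏_{j=1}^β u_j^{2/β − 1}(1 − u_j)^{2/β − 1} · ∏_{1≤j<k≤β} |u_k − u_j|^{4/β} on (0,1)^β, and for integers N ≥ 3 define J_N(x) := ∫_{[0,1]^β} ∏_{j=1}^β (1 − (1 − e^{2πix/N})u_j)^{N−2} · w(u) du (a complex-valued, absolutely convergent integral). Then lim_{N→∞} J_N(x) = I(x) := ∫_{[0,1]^β} ∏_{j=1}^β e^{2πix·u_j} · w(u) du. -/

import Mathlib

open MeasureTheory Real Filter Topology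

/-- The Selberg-type weight
`w(u) = ∏_j u_j^{2/β−1}(1−u_j)^{2/β−1} ∏_{j<k} |u_k−u_j|^{4/β}`. -/
noncomputable def selbergW (β : ℕ) (u : Fin β → ℝ) : ℝ :=
  (∏ j : Fin β, u j ^ ((2 : ℝ) / β - 1) * (1 - u j) ^ ((2 : ℝ) / β - 1)) *
    ∏ j : Fin β, ∏ k ∈ Finset.Ioi j, |u k - u j| ^ ((4 : ℝ) / β)

/-- The β-dimensional integral `J_N(x)` representing (up to explicit prefactors) the
bulk-scaled two-point correlation of the circular β-ensemble with β even. -/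
noncomputable def JN (β : ℕ) (N : ℕ) (x : ℝ) : ℂ :=
  ∫ u in Set.univ.pi fun _ : Fin β => Set.Icc (0 : ℝ) 1,
    (∏ j : Fin β,
        (1 - (1 - Complex.exp (2 * (π : ℂ) * Complex.I * (x : ℂ) / (N : ℂ))) * (u j : ℂ))
          ^ (N - 2)) *
      (selbergW β u : ℂ)

/-- The limiting β-dimensional integral `I(x)`. -/
noncomputable def Ilim (β : ℕ) (x : ℝ) : ℂ :=
  ∫ u in Set.univ.pi fun _ : Fin β => Set.Icc (0 : ℝ) 1,
    (∏ j : Fin β, Complex.exp (2 * (π : ℂ) * Complex.I * (x : ℂ) * (u j : ℂ))) *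
      (selbergW β u : ℂ)

lemma aux_one (a : ℝ) (ha : 0 < a) :
    Integrable (fun t : ℝ => t ^ (a - 1) * (1 - t) ^ (a - 1))
      (volume.restrict (Set.Icc (0 : ℝ) 1)) := by
  have h := Complex.betaIntegral_convergent (u := (a : ℂ)) (v := (a : ℂ)) (by simpa) (by simpa)
  rw [intervalIntegrable_iff_integrableOn_Ioo_of_le zero_le_one] at h
  have h2 := h.norm
  change IntegrableOn _ _ _
  rw [integrableOn_Icc_iff_integrableOn_Ioo]
  refine IntegrableOn.congr_fun h2 ?_ measurableSet_Ioo
  intro t ht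
  have h1 : (1 : ℂ) - (t : ℂ) = ((1 - t : ℝ) : ℂ) := by push_cast; rfl
  simp only [norm_mul]
  rw [h1, Complex.norm_cpow_eq_rpow_re_of_pos ht.1,
    Complex.norm_cpow_eq_rpow_re_of_pos (by linarith [ht.2])]
  simp

lemma aux_lim (c : ℂ) (s : ℂ) :
    Tendsto (fun N : ℕ => (1 - (1 - Complex.exp (c / (N : ℂ))) * s) ^ (N - 2)) atTop
      (𝓝 (Complex.exp (c * s))) := by
  have hinv : Tendsto (fun N : ℕ => ((N : ℂ))⁻¹) atTop (𝓝 0) :=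
    tendsto_inv_atTop_nhds_zero_nat (𝕜 := ℂ)
  have hd : HasDerivAt (fun z : ℂ => Complex.exp (c * z)) c 0 := by
    have := ((hasDerivAt_id (0 : ℂ)).const_mul c).cexp
    simpa using this
  have hne : Tendsto (fun N : ℕ => ((N : ℂ))⁻¹) atTop (𝓝[≠] 0) := by
    rw [tendsto_nhdsWithin_iff]
    refine ⟨hinv, ?_⟩
    filter_upwards [eventually_gt_atTop 0] with N hN
    simp; omega
  have hs := (hd.tendsto_slope_zero).comp hne
  have hg : Tendsto (fun N : ℕ => (N : ℂ) * (-((1 - Complex.exp (c / (N : ℂ))) * s))) atTop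
      (𝓝 (c * s)) := by
    refine (hs.mul_const s).congr fun N => ?_
    simp [div_eq_mul_inv]
    ring
  have hp := Complex.tendsto_one_add_pow_exp_of_tendsto hg
  have hb : Tendsto (fun N : ℕ => 1 + (-((1 - Complex.exp (c / (N : ℂ))) * s))) atTop
      (𝓝 1) := by
    have h0 : Tendsto (fun N : ℕ => Complex.exp (c * (N : ℂ)⁻¹)) atTop (𝓝 1) := by
      have := (hd.continuousAt.tendsto).comp hinv
      simpa [Function.comp_def] using this
    have := (((h0.const_sub 1).mul_const s).neg).const_add 1
    simpa [div_eq_mul_inv] using this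
  have hq := hp.div (hb.pow 2) (by simp)
  simp only [one_pow, div_one] at hq
  refine hq.congr' ?_
  filter_upwards [eventually_ge_atTop 2, hb.eventually_ne one_ne_zero] with N hN h0
  simp only [Pi.div_apply]
  rw [sub_eq_add_neg 1 ((1 - Complex.exp (c / (N : ℂ))) * s), pow_sub₀ _ h0 hN, div_eq_mul_inv]

lemma aux_norm (N : ℕ) (x t : ℝ) (ht : t ∈ Set.Icc (0 : ℝ) 1) :
    ‖(1 - (1 - Complex.exp (2 * (π : ℂ) * Complex.I * (x : ℂ) / (N : ℂ))) * (t : ℂ))‖ ≤ 1 := by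
  have hz : ‖Complex.exp (2 * (π : ℂ) * Complex.I * (x : ℂ) / (N : ℂ))‖ = 1 := by
    have : 2 * (π : ℂ) * Complex.I * (x : ℂ) / (N : ℂ)
        = ((2 * π * x / N : ℝ) : ℂ) * Complex.I := by push_cast; ring
    rw [this, Complex.norm_exp_ofReal_mul_I]
  set z := Complex.exp (2 * (π : ℂ) * Complex.I * (x : ℂ) / (N : ℂ))
  have : 1 - (1 - z) * (t : ℂ) = ((1 - t : ℝ) : ℂ) + z * (t : ℂ) := by push_cast; ring
  rw [this]
  refine (norm_add_le _ _).trans ?_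
  rw [norm_mul, hz, Complex.norm_real, Complex.norm_real, Real.norm_of_nonneg ht.1,
    Real.norm_of_nonneg (by linarith [ht.2])]
  linarith

lemma aux_W_meas (β : ℕ) : Measurable (selbergW β) := by
  unfold selbergW
  fun_prop

lemma aux_W_bound (β : ℕ) (u : Fin β → ℝ) (hu : ∀ j, u j ∈ Set.Icc (0 : ℝ) 1) :
    ‖(selbergW β u : ℂ)‖ ≤
      ∏ j : Fin β, u j ^ ((2 : ℝ) / β - 1) * (1 - u j) ^ ((2 : ℝ) / β - 1) := by
  have h1 : 0 ≤ ∏ j : Fin β, u j ^ ((2 : ℝ) / β - 1) * (1 - u j) ^ ((2 : ℝ) / β - 1) :=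
    Finset.prod_nonneg fun j _ => mul_nonneg (Real.rpow_nonneg (hu j).1 _)
      (Real.rpow_nonneg (by linarith [(hu j).2]) _)
  have h2 : 0 ≤ ∏ j : Fin β, ∏ k ∈ Finset.Ioi j, |u k - u j| ^ ((4 : ℝ) / β) := by positivity
  have h3 : ∏ j : Fin β, ∏ k ∈ Finset.Ioi j, |u k - u j| ^ ((4 : ℝ) / β) ≤ 1 := by
    refine Finset.prod_le_one (fun j _ => by positivity) fun j _ => ?_
    refine Finset.prod_le_one (fun k _ => by positivity) fun k _ => ?_
    refine Real.rpow_le_one (abs_nonneg _) ?_ (by positivity)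
    rw [abs_le]
    constructor <;> linarith [(hu j).1, (hu j).2, (hu k).1, (hu k).2]
  rw [Complex.norm_real, selbergW, Real.norm_of_nonneg (mul_nonneg h1 h2)]
  exact mul_le_of_le_one_right h1 h3

/-- For β a positive even integer and fixed real `x`, `J_N(x) → I(x)` as `N → ∞`. -/
theorem duality_integral_limit (β : ℕ) (hβ : 0 < β) (hβe : Even β) (x : ℝ) :
    Tendsto (fun N : ℕ => JN β N x) atTop (𝓝 (Ilim β x)) := by
  unfold JN Ilim
  have hW := aux_W_meas β
  have hbox : MeasurableSet (Set.univ.pi fun _ : Fin β => Set.Icc (0 : ℝ) 1) :=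
    MeasurableSet.univ_pi fun _ => measurableSet_Icc
  refine tendsto_integral_of_dominated_convergence
    (fun u => ∏ j : Fin β, u j ^ ((2 : ℝ) / β - 1) * (1 - u j) ^ ((2 : ℝ) / β - 1)) ?_ ?_ ?_ ?_
  · intro N
    refine Measurable.aestronglyMeasurable ?_
    fun_prop
  · rw [volume_pi, Measure.restrict_pi_pi]
    exact Integrable.fintype_prod (f := fun (_ : Fin β) (t : ℝ) =>
      t ^ ((2 : ℝ) / β - 1) * (1 - t) ^ ((2 : ℝ) / β - 1)) fun _ => aux_one _ (by positivity)
  · intro N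
    filter_upwards [ae_restrict_mem hbox] with u hu
    have hu' : ∀ j, u j ∈ Set.Icc (0 : ℝ) 1 := fun j => hu j trivial
    rw [norm_mul]
    refine (mul_le_of_le_one_left (norm_nonneg _) ?_).trans (aux_W_bound β u hu')
    rw [norm_prod]
    refine Finset.prod_le_one (fun j _ => norm_nonneg _) fun j _ => ?_
    rw [norm_pow]
    exact pow_le_one₀ (norm_nonneg _) (aux_norm N x _ (hu' j))
  · refine Eventually.of_forall fun u => ?_
    refine Tendsto.mul_const _ ?_
    exact tendsto_finsetProd _ fun j _ => aux_lim _ _
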